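/- Let P be a standard parabolic submonoid of M satisfying Assumption 1, let g be a P-ribbon, and let x ∈ P, y ∈ M. Then g left-divides x y if and only if g left-divides y. -/

import Mathlib

/-!
Common setting: Garside monoids, standard parabolic submonoids, heads,
ribbons, following Digne–Michel, "Ribbons in Garside monoids".
-/

namespace GarsidePaper

variable {M : Type*}

/-- `a` left-divides `b` : `b = a * c` for some `c`. -/
def LDvd [Monoid M] (a b : M) : Prop := ∃ c, b = a * c

/-- `a` right-divides `b` : `b = c * a` for some `c`. -/
def RDvd [Monoid M] (a b : M) : Prop := ∃ c, b = c * a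

/-- `a` is a factor of `b` : `a` left-divides a right-divisor of `b`. -/
def IsFactor [Monoid M] (a b : M) : Prop := ∃ c, LDvd a c ∧ RDvd c b

/-- A Garside structure on a (left- and right-) cancellative monoid `M`:
left/right gcds and lcms, Noetherianity, and a Garside element `Δ`. -/
structure GarsideStruct (M : Type*) [CancelMonoid M] where
  /-- left-gcd : gcd for the left-divisibility order -/
  lgcd : M → M → M
  lgcd_dvd_left : ∀ a b, LDvd (lgcd a b) a
  lgcd_dvd_right : ∀ a b, LDvd (lgcd a b) b
  lgcd_greatest : ∀ a b d, LDvd d a → LDvd d b → LDvd d (lgcd a b)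
  /-- right-lcm : lcm for the left-divisibility order -/
  rlcm : M → M → M
  ldvd_rlcm_left : ∀ a b, LDvd a (rlcm a b)
  ldvd_rlcm_right : ∀ a b, LDvd b (rlcm a b)
  rlcm_least : ∀ a b m, LDvd a m → LDvd b m → LDvd (rlcm a b) m
  /-- right-gcd : gcd for the right-divisibility order -/
  rgcd : M → M → M
  rgcd_dvd_left : ∀ a b, RDvd (rgcd a b) a
  rgcd_dvd_right : ∀ a b, RDvd (rgcd a b) b
  rgcd_greatest : ∀ a b d, RDvd d a → RDvd d b → RDvd d (rgcd a b)
  /-- left-lcm : lcm for the right-divisibility order -/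
  llcm : M → M → M
  rdvd_llcm_left : ∀ a b, RDvd a (llcm a b)
  rdvd_llcm_right : ∀ a b, RDvd b (llcm a b)
  llcm_least : ∀ a b m, RDvd a m → RDvd b m → RDvd (llcm a b) m
  /-- Noetherian: no infinite sequence where each term is a proper factor
  of the previous one. -/
  noetherian : WellFounded (fun a b : M => IsFactor a b ∧ a ≠ b)
  /-- the Garside element -/
  Δ : M
  /-- the left- and right-divisors of `Δ` coincide -/
  delta_balanced : ∀ a : M, LDvd a Δ ↔ RDvd a Δ
  /-- the divisors of `Δ` generate `M` -/
  delta_generates : Submonoid.closure {a : M | LDvd a Δ} = ⊤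

variable [CancelMonoid M]

/-- An atom: an element with no proper nontrivial divisor (factor). -/
def IsAtom' (a : M) : Prop := a ≠ 1 ∧ ∀ b : M, IsFactor b a → b = 1 ∨ b = a

/-- A standard parabolic submonoid: a submonoid closed under factors in which
every element of `M` has a maximal left-divisor (the left `P`-head) and a
maximal right-divisor (the right `P`-head) lying in `P`. -/
structure IsStdParabolic (P : Submonoid M) : Prop where
  factor_closed : ∀ a b : M, b ∈ P → IsFactor a b → a ∈ P
  exists_left_head : ∀ g : M, ∃ h, h ∈ P ∧ LDvd h g ∧
    ∀ h', h' ∈ P → LDvd h' g → LDvd h' h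
  exists_right_head : ∀ g : M, ∃ h, h ∈ P ∧ RDvd h g ∧
    ∀ h', h' ∈ P → RDvd h' g → RDvd h' h

/-- `h` is the left `P`-head `H_P g` of `g` : the maximal left-divisor of `g`
lying in `P`. -/
def IsLeftHead (P : Set M) (g h : M) : Prop :=
  h ∈ P ∧ LDvd h g ∧ ∀ h', h' ∈ P → LDvd h' g → LDvd h' h

/-- `h` is the right `P`-head of `g` : the maximal right-divisor of `g`
lying in `P`. -/
def IsRightHead (P : Set M) (g h : M) : Prop :=
  h ∈ P ∧ RDvd h g ∧ ∀ h', h' ∈ P → RDvd h' g → RDvd h' h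

/-- `g` is `P`-reduced : `H_P g = 1`, i.e. the only left-divisor of `g`
lying in `P` is `1`. -/
def PReduced (P : Set M) (g : M) : Prop := ∀ h ∈ P, LDvd h g → h = 1

/-- `P ^ g` is defined: `p ^ g` is defined (`g ≼ p * g`) for every `p ∈ P`. -/
def ConjSetDef (P : Set M) (g : M) : Prop := ∀ p ∈ P, LDvd g (p * g)

/-- The set `P ^ g = { p ^ g : p ∈ P }`, where `p ^ g` is the unique `c`
with `p * g = g * c`. -/
def conjSet (P : Set M) (g : M) : Set M := {c : M | ∃ p ∈ P, p * g = g * c}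

/-- A `P`-ribbon: a `P`-reduced element `g` such that `P ^ g` is defined. -/
def IsRibbon (P : Set M) (g : M) : Prop := PReduced P g ∧ ConjSetDef P g

/-- `P` is the smallest standard parabolic submonoid containing `S₁`. -/
def IsSmallestParabolicContaining (S₁ : Set M) (P : Submonoid M) : Prop :=
  IsStdParabolic P ∧ S₁ ⊆ (P : Set M) ∧
    ∀ Q : Submonoid M, IsStdParabolic Q → S₁ ⊆ (Q : Set M) → P ≤ Q

/-- Assumption 1: for any set `S₁` of atoms, the right-lcm of `S₁` is the
Garside element `Δ_{P₁} = H_{P₁}(Δ)` of the smallest standard parabolic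
submonoid `P₁` containing `S₁`. -/
def Assumption1 (G : GarsideStruct M) : Prop :=
  ∀ S₁ : Set M, (∀ s ∈ S₁, IsAtom' s) →
    ∀ P₁ : Submonoid M, IsSmallestParabolicContaining S₁ P₁ →
      ∀ d : M, IsLeftHead (P₁ : Set M) G.Δ d →
        (∀ s ∈ S₁, LDvd s d) ∧ ∀ m : M, (∀ s ∈ S₁, LDvd s m) → LDvd d m

/-- Assumption 2: some (positive) power of `Δ` is central. -/
def Assumption2 (G : GarsideStruct M) : Prop :=
  ∃ n : ℕ, 0 < n ∧ ∀ x : M, G.Δ ^ n * x = x * G.Δ ^ n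

/-- `v = v_{s,P}` : the element defined by `Δ_{P_s} = Δ_P * v`, where `P_s`
is the smallest standard parabolic submonoid containing `P` and `s`. -/
def IsVsp (G : GarsideStruct M) (P : Submonoid M) (s v : M) : Prop :=
  ∃ Ps : Submonoid M, IsSmallestParabolicContaining ((P : Set M) ∪ {s}) Ps ∧
    ∃ dP dPs : M, IsLeftHead (P : Set M) G.Δ dP ∧
      IsLeftHead (Ps : Set M) G.Δ dPs ∧ dPs = dP * v

theorem LDvd.isFactor {a b : M} (h : LDvd a b) : IsFactor a b :=
  ⟨b, h, 1, (one_mul b).symm⟩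

theorem RDvd.isFactor {a b : M} (h : RDvd a b) : IsFactor a b :=
  ⟨a, ⟨1, (mul_one a).symm⟩, h⟩

theorem isFactor_mul_mul (u a w : M) : IsFactor a (u * a * w) :=
  ⟨a * w, ⟨w, rfl⟩, u, mul_assoc u a w⟩

theorem LDvd.trans {a b c : M} (h : LDvd a b) (k : LDvd b c) : LDvd a c := by
  obtain ⟨u, rfl⟩ := h
  obtain ⟨w, rfl⟩ := k
  exact ⟨u * w, mul_assoc a u w⟩

namespace GarsideStruct

theorem isFactor_antisymm (G : GarsideStruct M) {a b : M} (h : IsFactor a b)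
    (k : IsFactor b a) : a = b := by
  by_contra hne
  exact G.noetherian.asymmetric a b ⟨h, hne⟩ ⟨k, fun e => hne e.symm⟩

theorem eq_one_of_mul_eq_one (G : GarsideStruct M) {a b : M} (h : a * b = 1) : a = 1 :=
  G.isFactor_antisymm (LDvd.isFactor ⟨b, h.symm⟩) (LDvd.isFactor ⟨a, (one_mul a).symm⟩)

theorem eq_one_of_mul_eq_one' (G : GarsideStruct M) {a b : M} (h : a * b = 1) : b = 1 := by
  rwa [G.eq_one_of_mul_eq_one h, one_mul] at h

/-- Every element is a product of atoms. -/
theorem mem_closure_atoms (G : GarsideStruct M) (x : M) :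
    x ∈ Submonoid.closure {a : M | IsAtom' a} := by
  induction x using G.noetherian.induction with
  | _ x ih =>
    by_cases hx1 : x = 1
    · rw [hx1]
      exact Submonoid.one_mem _
    by_cases hx : IsAtom' x
    · exact Submonoid.subset_closure hx
    have hex : ∃ b, IsFactor b x ∧ b ≠ 1 ∧ b ≠ x := by
      by_contra! hcon
      exact hx ⟨hx1, fun b hb => or_iff_not_imp_left.2 (hcon b hb)⟩
    obtain ⟨b, hbx, hb1, hbne⟩ := hex
    have hb := ih b ⟨hbx, hbne⟩
    obtain ⟨c, ⟨w, rfl⟩, u, rfl⟩ := hbx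
    refine Submonoid.mul_mem _ (ih u ⟨LDvd.isFactor ⟨_, rfl⟩, fun h => hb1 ?_⟩)
      (Submonoid.mul_mem _ hb (ih w ⟨RDvd.isFactor ⟨u * b, (mul_assoc _ _ _).symm⟩,
        fun h => hb1 ?_⟩))
    · exact G.eq_one_of_mul_eq_one (mul_eq_left.1 h.symm)
    · rw [← mul_assoc] at h
      exact G.eq_one_of_mul_eq_one' (mul_eq_right.1 h.symm)

theorem exists_atom_ldvd (G : GarsideStruct M) {x : M} (hx : x ≠ 1) :
    ∃ s, IsAtom' s ∧ LDvd s x := by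
  refine Or.resolve_left (?_ : x = 1 ∨ _) hx
  induction G.mem_closure_atoms x using Submonoid.closure_induction with
  | mem a ha => exact Or.inr ⟨a, ha, 1, (mul_one a).symm⟩
  | one => exact Or.inl rfl
  | mul a b _ _ iha ihb =>
    by_cases ha : a = 1
    · subst ha
      rw [one_mul] at hx ⊢
      exact ihb hx
    · obtain ⟨s, hs, h⟩ := (iha ha).resolve_left ha
      exact Or.inr ⟨s, hs, h.trans ⟨b, rfl⟩⟩

theorem exists_simple_ldvd (G : GarsideStruct M) (x : M) :
    x = 1 ∨ ∃ s, s ≠ 1 ∧ LDvd s G.Δ ∧ LDvd s x := by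
  have hx : x ∈ Submonoid.closure {a : M | LDvd a G.Δ} := by
    rw [G.delta_generates]
    exact Submonoid.mem_top x
  induction hx using Submonoid.closure_induction with
  | mem a ha =>
    by_cases h : a = 1
    · exact Or.inl h
    · exact Or.inr ⟨a, h, ha, 1, (mul_one a).symm⟩
  | one => exact Or.inl rfl
  | mul a b _ _ iha ihb =>
    rcases iha with rfl | ⟨s, hs, h, k⟩
    · rwa [one_mul]
    · exact Or.inr ⟨s, hs, h, k.trans ⟨b, rfl⟩⟩

theorem atom_ldvd_delta (G : GarsideStruct M) {s : M} (hs : IsAtom' s) : LDvd s G.Δ := by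
  obtain h | ⟨a, ha, had, has⟩ := G.exists_simple_ldvd s
  · exact absurd h hs.1
  · rwa [← (hs.2 a has.isFactor).resolve_left ha]

end GarsideStruct

namespace IsStdParabolic

variable {P Q : Submonoid M}

theorem left_mem_of_mul_mem (hP : IsStdParabolic P) {a b : M} (h : a * b ∈ P) : a ∈ P :=
  hP.factor_closed a _ h (LDvd.isFactor ⟨b, rfl⟩)

theorem right_mem_of_mul_mem (hP : IsStdParabolic P) {a b : M} (h : a * b ∈ P) : b ∈ P :=
  hP.factor_closed b _ h (RDvd.isFactor ⟨a, rfl⟩)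

theorem mem_closure_inter (hP : IsStdParabolic P) {S : Set M} {x : M}
    (hx : x ∈ Submonoid.closure S) (hxP : x ∈ P) :
    x ∈ Submonoid.closure (S ∩ (P : Set M)) := by
  induction hx using Submonoid.closure_induction with
  | mem a ha => exact Submonoid.subset_closure ⟨ha, hxP⟩
  | one => exact Submonoid.one_mem _
  | mul a b _ _ iha ihb =>
    exact Submonoid.mul_mem _ (iha (hP.left_mem_of_mul_mem hxP))
      (ihb (hP.right_mem_of_mul_mem hxP))

theorem le_of_atoms_subset (G : GarsideStruct M) (hP : IsStdParabolic P)
    (h : {a : M | IsAtom' a} ∩ (P : Set M) ⊆ Q) : P ≤ Q := fun x hx =>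
  Submonoid.closure_le.2 h (hP.mem_closure_inter (G.mem_closure_atoms x) hx)

theorem top (M : Type*) [CancelMonoid M] : IsStdParabolic (⊤ : Submonoid M) where
  factor_closed _ _ _ _ := Submonoid.mem_top _
  exists_left_head g := ⟨g, Submonoid.mem_top _, ⟨1, (mul_one g).symm⟩, fun _ _ h => h⟩
  exists_right_head g := ⟨g, Submonoid.mem_top _, ⟨1, (one_mul g).symm⟩, fun _ _ h => h⟩

theorem rlcm_mem (G : GarsideStruct M) (hP : IsStdParabolic P) {a b g : M} (ha : a ∈ P)
    (hb : b ∈ P) (hag : LDvd a g) (hbg : LDvd b g) : G.rlcm a b ∈ P := by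
  obtain ⟨h, hh, -, hmax⟩ := hP.exists_left_head g
  exact hP.factor_closed _ _ hh
    (G.rlcm_least _ _ _ (hmax a ha hag) (hmax b hb hbg)).isFactor

theorem llcm_mem (G : GarsideStruct M) (hP : IsStdParabolic P) {a b g : M} (ha : a ∈ P)
    (hb : b ∈ P) (hag : RDvd a g) (hbg : RDvd b g) : G.llcm a b ∈ P := by
  obtain ⟨h, hh, -, hmax⟩ := hP.exists_right_head g
  exact hP.factor_closed _ _ hh
    (G.llcm_least _ _ _ (hmax a ha hag) (hmax b hb hbg)).isFactor

theorem sInf (G : GarsideStruct M) {F : Set (Submonoid M)}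
    (hF : ∀ P ∈ F, IsStdParabolic P) : IsStdParabolic (sInf F) where
  factor_closed a b hb hab := by
    rw [Submonoid.mem_sInf] at hb ⊢
    exact fun P hP => (hF P hP).factor_closed a b (hb P hP) hab
  exists_left_head g := by
    obtain ⟨b, ⟨h, hh, hg⟩, hmin⟩ := G.noetherian.has_min
      {b : M | ∃ a ∈ InfSet.sInf F, g = a * b} ⟨g, 1, Submonoid.one_mem _, (one_mul g).symm⟩
    refine ⟨h, hh, ⟨b, hg⟩, fun k hk hkg => ?_⟩
    have hl : G.rlcm h k ∈ InfSet.sInf F := by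
      rw [Submonoid.mem_sInf] at hh hk ⊢
      exact fun P hP => (hF P hP).rlcm_mem G (hh P hP) (hk P hP) ⟨b, hg⟩ hkg
    obtain ⟨b', hb'⟩ := G.rlcm_least h k g ⟨b, hg⟩ hkg
    obtain ⟨e, he⟩ := G.ldvd_rlcm_left h k
    have hbe : b = e * b' := by
      rw [hg, he, mul_assoc] at hb'
      exact mul_left_cancel hb'
    have hbb : b' = b := by
      by_contra hne
      exact hmin b' ⟨_, hl, hb'⟩ ⟨RDvd.isFactor ⟨e, hbe⟩, hne⟩
    rw [hbb] at hbe
    rw [mul_eq_right.1 hbe.symm, mul_one] at he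
    rw [← he]
    exact G.ldvd_rlcm_right h k
  exists_right_head g := by
    obtain ⟨b, ⟨h, hh, hg⟩, hmin⟩ := G.noetherian.has_min
      {b : M | ∃ a ∈ InfSet.sInf F, g = b * a} ⟨g, 1, Submonoid.one_mem _, (mul_one g).symm⟩
    refine ⟨h, hh, ⟨b, hg⟩, fun k hk hkg => ?_⟩
    have hl : G.llcm h k ∈ InfSet.sInf F := by
      rw [Submonoid.mem_sInf] at hh hk ⊢
      exact fun P hP => (hF P hP).llcm_mem G (hh P hP) (hk P hP) ⟨b, hg⟩ hkg
    obtain ⟨b', hb'⟩ := G.llcm_least h k g ⟨b, hg⟩ hkg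
    obtain ⟨e, he⟩ := G.rdvd_llcm_left h k
    have hbe : b = b' * e := by
      rw [hg, he, ← mul_assoc] at hb'
      exact mul_right_cancel hb'
    have hbb : b' = b := by
      by_contra hne
      exact hmin b' ⟨_, hl, hb'⟩ ⟨LDvd.isFactor ⟨e, hbe⟩, hne⟩
    rw [hbb] at hbe
    rw [mul_eq_left.1 hbe.symm, one_mul] at he
    rw [← he]
    exact G.rdvd_llcm_right h k

end IsStdParabolic

theorem exists_isSmallestParabolicContaining (G : GarsideStruct M) (S : Set M) :
    ∃ Q : Submonoid M, IsSmallestParabolicContaining S Q := by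
  refine ⟨sInf {Q | IsStdParabolic Q ∧ S ⊆ (Q : Set M)},
    IsStdParabolic.sInf G fun Q hQ => hQ.1, fun s hs => ?_,
    fun Q hQ hSQ => sInf_le ⟨hQ, hSQ⟩⟩
  exact Submonoid.mem_sInf.2 fun Q hQ => hQ.2 hs

section Head

variable {P Q : Submonoid M} {d : M}

/-- The left and right heads of `Δ` in a standard parabolic submonoid agree. -/
theorem IsLeftHead.isRightHead_delta (G : GarsideStruct M) (hP : IsStdParabolic P)
    (hd : IsLeftHead (P : Set M) G.Δ d) : IsRightHead (P : Set M) G.Δ d := by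
  obtain ⟨r, hr, hrd, hmax⟩ := hP.exists_right_head G.Δ
  have h : d = r := G.isFactor_antisymm
    (hmax d hd.1 ((G.delta_balanced d).1 hd.2.1)).isFactor
    (hd.2.2 r hr ((G.delta_balanced r).2 hrd)).isFactor
  rw [h]
  exact ⟨hr, hrd, hmax⟩

theorem IsLeftHead.ldvd_iff_rdvd (G : GarsideStruct M) (hP : IsStdParabolic P)
    (hd : IsLeftHead (P : Set M) G.Δ d) {a : M} : LDvd a d ↔ RDvd a d := by
  have hd' := hd.isRightHead_delta G hP
  constructor
  · intro h
    exact hd'.2.2 a (hP.factor_closed a d hd.1 h.isFactor)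
      ((G.delta_balanced a).1 (h.trans hd.2.1))
  · intro h
    refine hd.2.2 a (hP.factor_closed a d hd.1 h.isFactor) ((G.delta_balanced a).2 ?_)
    obtain ⟨u, hu⟩ := h
    obtain ⟨w, hw⟩ := hd'.2.1
    exact ⟨w * u, by rw [hw, mul_assoc, ← hu]⟩

theorem IsLeftHead.exists_conj (G : GarsideStruct M) (hP : IsStdParabolic P)
    (hd : IsLeftHead (P : Set M) G.Δ d) {q : M} (hq : q ∈ P) :
    ∃ q' ∈ P, q * d = d * q' := by
  have hx : q ∈ Submonoid.closure ({a : M | LDvd a G.Δ} ∩ (P : Set M)) :=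
    hP.mem_closure_inter (by rw [G.delta_generates]; exact Submonoid.mem_top q) hq
  clear hq
  induction hx using Submonoid.closure_induction with
  | mem a ha =>
    obtain ⟨r, hr⟩ := hd.2.2 a ha.2 ha.1
    obtain ⟨a', ha'⟩ := (hd.ldvd_iff_rdvd G hP).2 ⟨a, hr⟩
    refine ⟨a', hP.right_mem_of_mul_mem (ha' ▸ hd.1), ?_⟩
    calc a * d = a * (r * a') := by rw [← ha']
      _ = d * a' := by rw [← mul_assoc, ← hr]
  | one => exact ⟨1, Submonoid.one_mem _, by rw [one_mul, mul_one]⟩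
  | mul a b _ _ iha ihb =>
    obtain ⟨a', ha', ha⟩ := iha
    obtain ⟨b', hb', hb⟩ := ihb
    exact ⟨a' * b', Submonoid.mul_mem _ ha' hb', by
      rw [mul_assoc, hb, ← mul_assoc, ha, mul_assoc]⟩

theorem IsLeftHead.exists_conj_symm (G : GarsideStruct M) (hP : IsStdParabolic P)
    (hd : IsLeftHead (P : Set M) G.Δ d) {q' : M} (hq : q' ∈ P) :
    ∃ q ∈ P, q * d = d * q' := by
  have hx : q' ∈ Submonoid.closure ({a : M | LDvd a G.Δ} ∩ (P : Set M)) :=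
    hP.mem_closure_inter (by rw [G.delta_generates]; exact Submonoid.mem_top q') hq
  clear hq
  induction hx using Submonoid.closure_induction with
  | mem a ha =>
    obtain ⟨r, hr⟩ := (hd.ldvd_iff_rdvd G hP).1 (hd.2.2 a ha.2 ha.1)
    obtain ⟨a', ha'⟩ := (hd.ldvd_iff_rdvd G hP).1 ⟨a, hr⟩
    refine ⟨a', hP.left_mem_of_mul_mem (ha' ▸ hd.1), ?_⟩
    calc a' * d = a' * (r * a) := by rw [← hr]
      _ = d * a := by rw [← mul_assoc, ← ha']
  | one => exact ⟨1, Submonoid.one_mem _, by rw [one_mul, mul_one]⟩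
  | mul a b _ _ iha ihb =>
    obtain ⟨a', ha', ha⟩ := iha
    obtain ⟨b', hb', hb⟩ := ihb
    exact ⟨a' * b', Submonoid.mul_mem _ ha' hb', by
      rw [mul_assoc, hb, ← mul_assoc, ha, mul_assoc]⟩

theorem IsLeftHead.ldvd_conj_iff (G : GarsideStruct M) (hP : IsStdParabolic P)
    (hd : IsLeftHead (P : Set M) G.Δ d) {a a' b b' : M} (ha : a * d = d * a')
    (hb : b * d = d * b') (hbP : b ∈ P) (hbP' : b' ∈ P) : LDvd a b ↔ LDvd a' b' := by
  constructor
  · rintro ⟨e, rfl⟩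
    obtain ⟨e', -, he⟩ := hd.exists_conj G hP (hP.right_mem_of_mul_mem hbP)
    exact ⟨e', mul_left_cancel (a := d) (by
      rw [← hb, mul_assoc, he, ← mul_assoc, ha, mul_assoc])⟩
  · rintro ⟨e', rfl⟩
    obtain ⟨e, -, he⟩ := hd.exists_conj_symm G hP (hP.right_mem_of_mul_mem hbP')
    exact ⟨e, mul_right_cancel (b := d) (by
      rw [hb, ← mul_assoc, ← ha, mul_assoc, ← he, mul_assoc])⟩

theorem IsLeftHead.rdvd_conj_iff (G : GarsideStruct M) (hP : IsStdParabolic P)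
    (hd : IsLeftHead (P : Set M) G.Δ d) {a a' b b' : M} (ha : a * d = d * a')
    (hb : b * d = d * b') (hbP : b ∈ P) (hbP' : b' ∈ P) : RDvd a b ↔ RDvd a' b' := by
  constructor
  · rintro ⟨e, rfl⟩
    obtain ⟨e', -, he⟩ := hd.exists_conj G hP (hP.left_mem_of_mul_mem hbP)
    exact ⟨e', mul_left_cancel (a := d) (by
      rw [← hb, mul_assoc, ha, ← mul_assoc, he, mul_assoc])⟩
  · rintro ⟨e', rfl⟩
    obtain ⟨e, -, he⟩ := hd.exists_conj_symm G hP (hP.left_mem_of_mul_mem hbP')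
    exact ⟨e, mul_right_cancel (b := d) (by
      rw [hb, ← mul_assoc, ← he, mul_assoc, ← ha, mul_assoc])⟩

/-- The conjugate `P ^ d`. -/
def conjSubmonoid (P : Submonoid M) (d : M) : Submonoid M where
  carrier := conjSet (P : Set M) d
  one_mem' := ⟨1, Submonoid.one_mem _, by rw [one_mul, mul_one]⟩
  mul_mem' := by
    rintro a b ⟨p, hp, hpa⟩ ⟨q, hq, hqb⟩
    exact ⟨p * q, Submonoid.mul_mem _ hp hq, by
      rw [mul_assoc, hqb, ← mul_assoc, hpa, mul_assoc]⟩

/-- Conjugation by `Δ_Q` maps the standard parabolic submonoids contained in `Q` to standard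
parabolic submonoids. -/
theorem IsLeftHead.isStdParabolic_conjSubmonoid (G : GarsideStruct M) (hP : IsStdParabolic P)
    (hQ : IsStdParabolic Q) (hPQ : P ≤ Q) (hd : IsLeftHead (Q : Set M) G.Δ d) :
    IsStdParabolic (conjSubmonoid P d) := by
  have hR : ∀ {p c : M}, p ∈ P → p * d = d * c → c ∈ Q := by
    intro p c hp hpc
    obtain ⟨c', hc', h⟩ := hd.exists_conj G hQ (hPQ hp)
    rwa [mul_left_cancel (hpc.symm.trans h)]
  refine ⟨?_, fun m => ?_, fun m => ?_⟩
  · rintro a b ⟨p, hp, hpb⟩ ⟨c, ⟨w, rfl⟩, u, rfl⟩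
    have hb := hR hp hpb
    obtain ⟨u', -, hu⟩ := hd.exists_conj_symm G hQ (hQ.left_mem_of_mul_mem hb)
    have haw := hQ.right_mem_of_mul_mem hb
    obtain ⟨a', -, ha⟩ := hd.exists_conj_symm G hQ (hQ.left_mem_of_mul_mem haw)
    obtain ⟨w', -, hw⟩ := hd.exists_conj_symm G hQ (hQ.right_mem_of_mul_mem haw)
    have hpe : p = u' * a' * w' := mul_right_cancel (b := d) (by
      rw [hpb, mul_assoc, hw, mul_assoc, ← mul_assoc a', ha, ← mul_assoc, ← mul_assoc,
        ← mul_assoc, ← mul_assoc, hu])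
    exact ⟨a', hP.factor_closed a' p hp (hpe ▸ isFactor_mul_mul u' a' w'), ha⟩
  · obtain ⟨q, hq, hqm, hqmax⟩ := hQ.exists_left_head m
    obtain ⟨q₁, hq₁, hqq⟩ := hd.exists_conj_symm G hQ hq
    obtain ⟨h₁, hh₁, hhq, hhmax⟩ := hP.exists_left_head q₁
    obtain ⟨h, hh, hhh⟩ := hd.exists_conj G hQ (hPQ hh₁)
    refine ⟨h, ⟨h₁, hh₁, hhh⟩, ((hd.ldvd_conj_iff G hQ hhh hqq hq₁ hq).1 hhq).trans hqm, ?_⟩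
    rintro k ⟨p, hp, hpk⟩ hkm
    have hpq := (hd.ldvd_conj_iff G hQ hpk hqq hq₁ hq).2 (hqmax k (hR hp hpk) hkm)
    exact (hd.ldvd_conj_iff G hQ hpk hhh (hPQ hh₁) hh).1 (hhmax p hp hpq)
  · obtain ⟨q, hq, hqm, hqmax⟩ := hQ.exists_right_head m
    obtain ⟨q₁, hq₁, hqq⟩ := hd.exists_conj_symm G hQ hq
    obtain ⟨h₁, hh₁, hhq, hhmax⟩ := hP.exists_right_head q₁
    obtain ⟨h, hh, hhh⟩ := hd.exists_conj G hQ (hPQ hh₁)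
    refine ⟨h, ⟨h₁, hh₁, hhh⟩, ?_, ?_⟩
    · obtain ⟨e, rfl⟩ := (hd.rdvd_conj_iff G hQ hhh hqq hq₁ hq).1 hhq
      obtain ⟨f, rfl⟩ := hqm
      exact ⟨f * e, (mul_assoc _ _ _).symm⟩
    rintro k ⟨p, hp, hpk⟩ hkm
    have hpq := (hd.rdvd_conj_iff G hQ hpk hqq hq₁ hq).2 (hqmax k (hR hp hpk) hkm)
    exact (hd.rdvd_conj_iff G hQ hpk hhh (hPQ hh₁) hh).1 (hhmax p hp hpq)

/-- If `Δ_Q = Δ_P * v`, then `P ^ v = P ^ Δ_Q`. -/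
theorem IsLeftHead.conjSubmonoid_eq (G : GarsideStruct M) (hP : IsStdParabolic P)
    (hd : IsLeftHead (P : Set M) G.Δ d) (v : M) :
    conjSubmonoid P v = conjSubmonoid P (d * v) := by
  ext c
  constructor
  · rintro ⟨p, hp, hpc⟩
    obtain ⟨q, hq, hqp⟩ := hd.exists_conj_symm G hP hp
    exact ⟨q, hq, by rw [← mul_assoc, hqp, mul_assoc, hpc, mul_assoc]⟩
  · rintro ⟨q, hq, hqc⟩
    obtain ⟨p, hp, hqp⟩ := hd.exists_conj G hP hq
    exact ⟨p, hp, mul_left_cancel (a := d) (by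
      rw [← mul_assoc, ← hqp, mul_assoc, hqc, mul_assoc])⟩

end Head

/-- A ribbon `v` such that `P ^ v` is closed under factors satisfies
`rlcm x v = x * v` for all `x ∈ P`. -/
theorem IsRibbon.ldvd_of_ldvd_mul (G : GarsideStruct M) {P : Submonoid M} {v : M}
    (hv : IsRibbon (P : Set M) v) (hR : IsStdParabolic (conjSubmonoid P v)) {x y : M}
    (hx : x ∈ P) (h : LDvd v (x * y)) : LDvd v y := by
  obtain ⟨c, hc⟩ := hv.2 x hx
  have hcR : c ∈ conjSubmonoid P v := ⟨x, hx, hc⟩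
  obtain ⟨w, hw⟩ := G.ldvd_rlcm_left x v
  obtain ⟨t, ht⟩ := G.ldvd_rlcm_right x v
  obtain ⟨u, hu⟩ := G.rlcm_least x v (x * v) ⟨v, rfl⟩ ⟨c, hc⟩
  have hctu : c = t * u := mul_left_cancel (a := v) (by rw [← hc, hu, ht, mul_assoc])
  rw [hctu] at hcR
  obtain ⟨q, hq, hqu⟩ := hR.right_mem_of_mul_mem hcR
  obtain ⟨p, hp, hpt⟩ := hR.left_mem_of_mul_mem hcR
  have hxpq : x = p * q := mul_right_cancel (b := v) (by
    rw [hc, hctu, mul_assoc, hqu, ← mul_assoc, ← mul_assoc, hpt])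
  have hqw : v = q * w := mul_left_cancel (a := p) (by
    rw [hpt, ← ht, hw, hxpq, mul_assoc])
  have hq1 : q = 1 := hv.1 q hq ⟨w, hqw⟩
  obtain ⟨z, hz⟩ := G.rlcm_least x v (x * y) ⟨y, rfl⟩ h
  rw [hq1, one_mul] at hqw
  rw [hw, ← hqw, mul_assoc] at hz
  exact ⟨z, mul_left_cancel hz⟩

/-- A nontrivial ribbon `g` is divisible by a nontrivial ribbon `v` such that `P ^ v` is a
standard parabolic submonoid. -/
theorem IsRibbon.exists_ldvd_isStdParabolic (G : GarsideStruct M) (hA : Assumption1 G)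
    {P : Submonoid M} (hP : IsStdParabolic P) {g : M} (hg : IsRibbon (P : Set M) g)
    (hg1 : g ≠ 1) :
    ∃ v, v ≠ 1 ∧ LDvd v g ∧ IsRibbon (P : Set M) v ∧
      IsStdParabolic (conjSubmonoid P v) := by
  obtain ⟨s, hs, hsg⟩ := G.exists_atom_ldvd hg1
  obtain ⟨Q, hQ⟩ := exists_isSmallestParabolicContaining G
    (({a : M | IsAtom' a} ∩ (P : Set M)) ∪ {s})
  have hPQ : P ≤ Q := hP.le_of_atoms_subset G (Set.subset_union_left.trans hQ.2.1)
  obtain ⟨d, hd⟩ : ∃ d, IsLeftHead (P : Set M) G.Δ d := hP.exists_left_head G.Δ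
  obtain ⟨e, he⟩ : ∃ e, IsLeftHead (Q : Set M) G.Δ e := hQ.1.exists_left_head G.Δ
  obtain ⟨v, rfl⟩ := he.2.2 d (hPQ hd.1) hd.2.1
  obtain ⟨hle, hleast⟩ := hA _ (by rintro a (ha | rfl); exacts [ha.1, hs]) Q hQ _ he
  have hvg : LDvd v g := by
    obtain ⟨z, hz⟩ := hleast (d * g) (by
      rintro a (ha | rfl)
      · exact (hd.2.2 a ha.2 (G.atom_ldvd_delta ha.1)).trans ⟨g, rfl⟩
      · exact hsg.trans (hg.2 d hd.1))
    exact ⟨z, mul_left_cancel (a := d) (by rw [hz, mul_assoc])⟩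
  have hR : IsStdParabolic (conjSubmonoid P v) := by
    rw [hd.conjSubmonoid_eq G hP]
    exact he.isStdParabolic_conjSubmonoid G hP hQ.1 hPQ
  refine ⟨v, ?_, hvg, ⟨fun p hp hpv => hg.1 p hp (hpv.trans hvg), fun p hp => ?_⟩, hR⟩
  · rintro rfl
    have hsd := hle s (Or.inr rfl)
    rw [mul_one] at hsd
    exact hs.1 (hg.1 s (hP.factor_closed s d hd.1 hsd.isFactor) hsg)
  · obtain ⟨q, hq, hqp⟩ := hd.exists_conj_symm G hP hp
    obtain ⟨c, -, hc⟩ := he.exists_conj G hQ.1 (hPQ hq)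
    exact ⟨c, mul_left_cancel (a := d) (by
      rw [← mul_assoc, ← hqp, mul_assoc, hc, mul_assoc])⟩

theorem IsRibbon.of_mul {P : Submonoid M} {v g : M} (h : IsRibbon (P : Set M) (v * g)) :
    IsRibbon (conjSubmonoid P v : Set M) g := by
  constructor
  · rintro c ⟨p, hp, hpc⟩ ⟨z, rfl⟩
    have hp1 := h.1 p hp ⟨v * z, by rw [← mul_assoc, ← hpc, mul_assoc]⟩
    rw [hp1, one_mul] at hpc
    exact mul_eq_left.1 hpc.symm
  · rintro c ⟨p, hp, hpc⟩
    obtain ⟨z, hz⟩ := h.2 p hp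
    exact ⟨z, mul_left_cancel (a := v) (by
      rw [← mul_assoc, ← hpc, mul_assoc, hz, mul_assoc])⟩

theorem IsRibbon.ldvd_of_ldvd_mul_of_assumption1 (G : GarsideStruct M) (hA : Assumption1 G)
    {P : Submonoid M} (hP : IsStdParabolic P) {g : M} (hg : IsRibbon (P : Set M) g)
    {x y : M} (hx : x ∈ P) (h : LDvd g (x * y)) : LDvd g y := by
  induction g using G.noetherian.induction generalizing P x y with
  | _ g ih =>
    by_cases hg1 : g = 1
    · exact ⟨y, by rw [hg1, one_mul]⟩
    obtain ⟨v, hv1, ⟨g', rfl⟩, hv, hR⟩ := hg.exists_ldvd_isStdParabolic G hA hP hg1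
    obtain ⟨z, rfl⟩ := hv.ldvd_of_ldvd_mul G hR hx (LDvd.trans ⟨g', rfl⟩ h)
    obtain ⟨c, hc⟩ := hv.2 x hx
    obtain ⟨w, hw⟩ := h
    obtain ⟨r, rfl⟩ := ih g' ⟨RDvd.isFactor ⟨v, rfl⟩, fun e => hv1 (mul_eq_right.1 e.symm)⟩ hR
      hg.of_mul (show c ∈ conjSubmonoid P v from ⟨x, hx, hc⟩)
      (show LDvd g' (c * z) from ⟨w, mul_left_cancel (a := v) (by
        rw [← mul_assoc, ← hc, mul_assoc, hw, mul_assoc])⟩)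
    exact ⟨r, (mul_assoc _ _ _).symm⟩

/-- if `g` is a `P`-ribbon, `x ∈ P` and `y ∈ M`, then
`g` left-divides `x * y` iff `g` left-divides `y`. -/
theorem statement7 (G : GarsideStruct M) (hA : Assumption1 G)
    (P : Submonoid M) (hP : IsStdParabolic P)
    (g : M) (hg : IsRibbon (P : Set M) g)
    (x y : M) (hx : x ∈ P) :
    LDvd g (x * y) ↔ LDvd g y := by
  refine ⟨hg.ldvd_of_ldvd_mul_of_assumption1 G hA hP hx, ?_⟩
  rintro ⟨z, rfl⟩
  obtain ⟨c, hc⟩ := hg.2 x hx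
  exact ⟨c * z, by rw [← mul_assoc, hc, mul_assoc]⟩

end GarsidePaper
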